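/- Let C be an isotropic centrally symmetric convex body in ℝⁿ and K a centrally symmetric convex body in ℝⁿ. There are absolute constants c₁, c₂ > 0 such that for every s ≥ 1 and every t ∈ ℝˢ, (c₁ L_C √n M(K) / T₂(X_K)) ‖t‖₂ ≤ ∫_C⋯∫_C ‖∑_{j=1}^s t_j x_j‖_K dx₁⋯dx_s ≤ c₂ T₂(X_K) (∫_C ‖x‖_K dx) ‖t‖₂. -/

import Mathlib

open MeasureTheory Real
open scoped ENNReal RealInnerProductSpace

noncomputable section

/-- A centrally symmetric convex body. -/
def IsSymmConvexBody {n : ℕ} (C : Set (EuclideanSpace ℝ (Fin n))) : Prop :=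
  Convex ℝ C ∧ IsCompact C ∧ (interior C).Nonempty ∧ C = -C

/-- `C` is isotropic with isotropic constant `L`. -/
def IsIsotropic {n : ℕ} (C : Set (EuclideanSpace ℝ (Fin n))) (L : ℝ) : Prop :=
  volume C = 1 ∧ (∫ x in C, x) = 0 ∧ 0 < L ∧
    ∀ ξ : EuclideanSpace ℝ (Fin n), ‖ξ‖ = 1 → (∫ x in C, ⟪x, ξ⟫ ^ 2) = L ^ 2

/-- The type-2 inequality for the norm `‖·‖_K` with constant `Tst`:
`(𝔼_ε ‖∑ ε_i x_i‖_K²)^{1/2} ≤ Tst (∑ ‖x_i‖_K²)^{1/2}` for all finite families. -/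
def TypeTwoIneq {n : ℕ} (K : Set (EuclideanSpace ℝ (Fin n))) (Tst : ℝ) : Prop :=
  ∀ (k : ℕ) (x : Fin k → EuclideanSpace ℝ (Fin n)),
    Real.sqrt ((2 ^ k : ℝ)⁻¹ *
        ∑ ε : Fin k → Bool, gauge K (∑ i, (if ε i then (1 : ℝ) else -1) • x i) ^ 2)
      ≤ Tst * Real.sqrt (∑ i, gauge K (x i) ^ 2)

/-- `M(K) = ∫_{S^{n-1}} ‖ξ‖_K dσ(ξ)`. -/
def sphereM {n : ℕ} (K : Set (EuclideanSpace ℝ (Fin n))) : ℝ :=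
  ⨍ ξ, gauge K (ξ : EuclideanSpace ℝ (Fin n))
    ∂((volume : Measure (EuclideanSpace ℝ (Fin n))).toSphere)

/-- The Euclidean norm of `t ∈ ℝˢ`. -/
def euclNorm {s : ℕ} (t : Fin s → ℝ) : ℝ := Real.sqrt (∑ j, t j ^ 2)

section Pointwise

open scoped Pointwise

/-- One-dimensional Brunn–Minkowski inequality for compact sets. -/
theorem volume_add_le_volume_add_set {A B : Set ℝ} (hA : IsCompact A) (hB : IsCompact B)
    (hA' : A.Nonempty) (hB' : B.Nonempty) : volume A + volume B ≤ volume (A + B) := by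
  obtain ⟨a, ha, hamax⟩ := hA.exists_isGreatest hA'
  obtain ⟨b, hb, hbmin⟩ := hB.exists_isLeast hB'
  have hsub : ((fun x => x + b) '' A) ∪ ((fun x => a + x) '' B) ⊆ A + B := by
    rintro _ (⟨x, hx, rfl⟩ | ⟨x, hx, rfl⟩)
    · exact Set.add_mem_add hx hb
    · exact Set.add_mem_add ha hx
  have hdisj : AEDisjoint volume ((fun x => x + b) '' A) ((fun x => a + x) '' B) := by
    refine measure_mono_null (t := {a + b}) ?_ (by simp)
    rintro _ ⟨⟨x, hx, rfl⟩, ⟨y, hy, hxy⟩⟩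
    have h1 := hamax hx
    have h2 := hbmin hy
    simp only at hxy
    simp only [Set.mem_singleton_iff]
    linarith
  refine le_trans (le_of_eq ?_) (measure_mono hsub)
  rw [measure_union₀ _ hdisj]
  · simp [Set.image_add_right, Set.image_add_left]
  · exact ((hB.image (by fun_prop)).measurableSet).nullMeasurableSet

theorem volume_add_le_two_mul {A B S : Set ℝ} (hA : MeasurableSet A) (hB : MeasurableSet B)
    (hA' : A.Nonempty) (hB' : B.Nonempty)
    (hS : ∀ x ∈ A, ∀ y ∈ B, (1 / 2 : ℝ) • (x + y) ∈ S) : volume A + volume B ≤ 2 * volume S := by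
  have key : ∀ K₁ ⊆ A, IsCompact K₁ → K₁.Nonempty → ∀ K₂ ⊆ B, IsCompact K₂ → K₂.Nonempty →
      volume K₁ + volume K₂ ≤ 2 * volume S := by
    intro K₁ h₁ hc₁ hn₁ K₂ h₂ hc₂ hn₂
    refine (volume_add_le_volume_add_set hc₁ hc₂ hn₁ hn₂).trans ?_
    have : K₁ + K₂ ⊆ (2 : ℝ) • S := by
      rintro _ ⟨x, hx, y, hy, rfl⟩
      refine ⟨_, hS x (h₁ hx) y (h₂ hy), ?_⟩
      simp
    refine (measure_mono this).trans (le_of_eq ?_)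
    rw [Measure.addHaar_smul]
    simp
  have key' : ∀ K₁ ⊆ A, IsCompact K₁ → ∀ K₂ ⊆ B, IsCompact K₂ →
      volume K₁ + volume K₂ ≤ 2 * volume S := by
    intro K₁ h₁ hc₁ K₂ h₂ hc₂
    obtain ⟨a, ha⟩ := hA'
    obtain ⟨b, hb⟩ := hB'
    refine le_trans ?_ (key (insert a K₁) (Set.insert_subset ha h₁) (hc₁.insert a)
      (Set.insert_nonempty _ _) (insert b K₂) (Set.insert_subset hb h₂) (hc₂.insert b)
      (Set.insert_nonempty _ _))
    gcongr <;> exact Set.subset_insert _ _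
  rw [hA.measure_eq_iSup_isCompact, hB.measure_eq_iSup_isCompact]
  have hne : ∀ D : Set ℝ, Nonempty {K : Set ℝ // K ⊆ D ∧ IsCompact K} := fun D =>
    ⟨⟨∅, Set.empty_subset _, isCompact_empty⟩⟩
  have := hne A
  have := hne B
  rw [show (⨆ K, ⨆ (_ : K ⊆ A), ⨆ (_ : IsCompact K), volume K) =
      ⨆ K : {K : Set ℝ // K ⊆ A ∧ IsCompact K}, volume K.1 by simp only [iSup_subtype, iSup_and],
    show (⨆ K, ⨆ (_ : K ⊆ B), ⨆ (_ : IsCompact K), volume K) =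
      ⨆ K : {K : Set ℝ // K ⊆ B ∧ IsCompact K}, volume K.1 by simp only [iSup_subtype, iSup_and]]
  exact ENNReal.iSup_add_iSup_le fun K₁ K₂ => key' _ K₁.2.1 K₁.2.2 _ K₂.2.1 K₂.2.2

end Pointwise

/-- The midpoint form of the Prékopa–Leindler inequality for the measure `μ`. -/
def MidpointPrekopaLeindler {E : Type*} [AddCommGroup E] [Module ℝ E] [MeasurableSpace E]
    (μ : Measure E) : Prop :=
  ∀ f g h : E → ℝ≥0∞, Measurable f → Measurable g → Measurable h →
    (∀ x y, f x * g y ≤ h ((1 / 2 : ℝ) • (x + y)) ^ 2) →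
    (∫⁻ x, f x ∂μ) * (∫⁻ x, g x ∂μ) ≤ (∫⁻ x, h x ∂μ) ^ 2

theorem MidpointPrekopaLeindler.prod {E F : Type*} [AddCommGroup E] [Module ℝ E]
    [MeasurableSpace E] [AddCommGroup F] [Module ℝ F] [MeasurableSpace F]
    {μ : Measure E} {ν : Measure F} [SFinite μ] [SFinite ν]
    (hμ : MidpointPrekopaLeindler μ) (hν : MidpointPrekopaLeindler ν) :
    MidpointPrekopaLeindler (μ.prod ν) := by
  intro f g h hf hg hh hfgh
  rw [lintegral_prod _ hf.aemeasurable, lintegral_prod _ hg.aemeasurable,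
    lintegral_prod _ hh.aemeasurable]
  refine hμ _ _ _ hf.lintegral_prod_right' hg.lintegral_prod_right' hh.lintegral_prod_right' ?_
  intro x y
  exact hν _ _ _ (by fun_prop) (by fun_prop) (by fun_prop) fun u v => hfgh (x, u) (y, v)

theorem MidpointPrekopaLeindler.of_measurePreserving {E F : Type*} [AddCommGroup E] [Module ℝ E]
    [MeasurableSpace E] [AddCommGroup F] [Module ℝ F] [MeasurableSpace F]
    {μ : Measure E} {ν : Measure F} (hμ : MidpointPrekopaLeindler μ) (T : E →ₗ[ℝ] F)
    (hT : MeasurePreserving T μ ν) : MidpointPrekopaLeindler ν := by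
  intro f g h hf hg hh hfgh
  rw [← hT.lintegral_comp hf, ← hT.lintegral_comp hg, ← hT.lintegral_comp hh]
  refine hμ _ _ _ (hf.comp hT.measurable) (hg.comp hT.measurable) (hh.comp hT.measurable) ?_
  intro x y
  simpa using hfgh (T x) (T y)

theorem midpointPrekopaLeindler_of_subsingleton {E : Type*} [AddCommGroup E] [Module ℝ E]
    [MeasurableSpace E] [Subsingleton E] (μ : Measure E) : MidpointPrekopaLeindler μ := by
  intro f g h hf hg hh hfgh
  have e : ∀ k : E → ℝ≥0∞, k = fun _ => k 0 := fun k => funext fun x => by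
    rw [Subsingleton.elim x 0]
  rw [e f, e g, e h]
  simp only [lintegral_const]
  calc f 0 * μ Set.univ * (g 0 * μ Set.univ) = (f 0 * g 0) * (μ Set.univ) ^ 2 := by ring
    _ ≤ (h 0) ^ 2 * (μ Set.univ) ^ 2 := by
        gcongr; simpa using hfgh 0 0
    _ = _ := by ring

theorem MidpointPrekopaLeindler.pi {E : Type*} [AddCommGroup E] [Module ℝ E] [MeasureSpace E]
    [SigmaFinite (volume : Measure E)] (hE : MidpointPrekopaLeindler (volume : Measure E)) (k : ℕ) :
    MidpointPrekopaLeindler (volume : Measure (Fin k → E)) := by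
  induction k with
  | zero => exact midpointPrekopaLeindler_of_subsingleton _
  | succ k ih =>
    refine (hE.prod ih).of_measurePreserving
      (Fin.consLinearEquiv ℝ (fun _ : Fin (k + 1) => E)).toLinearMap ?_
    have h := (volume_preserving_piFinSuccAbove (fun _ : Fin (k + 1) => E) 0).symm
    have e : ⇑(MeasurableEquiv.piFinSuccAbove (fun _ : Fin (k + 1) => E) 0).symm =
        ⇑(Fin.consLinearEquiv ℝ (fun _ : Fin (k + 1) => E)).toLinearMap := by
      ext x i
      refine Fin.cases ?_ (fun j => ?_) i <;> simp [MeasurableEquiv.piFinSuccAbove]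
    rw [e] at h
    exact h

theorem lintegral_add_le_two_mul_of_forall_exists_lt {f g h : ℝ → ℝ} (hf : Measurable f)
    (hg : Measurable g) (hh : Measurable h) (hf0 : ∀ x, 0 ≤ f x) (hg0 : ∀ x, 0 ≤ g x)
    (hh0 : ∀ x, 0 ≤ h x) (hf1 : ∀ x, f x ≤ 1) (hg1 : ∀ x, g x ≤ 1)
    (hf2 : ∀ t < 1, ∃ x, t < f x) (hg2 : ∀ t < 1, ∃ x, t < g x)
    (hfgh : ∀ x y, f x * g y ≤ h ((1 / 2 : ℝ) • (x + y)) ^ 2) :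
    (∫⁻ x, ENNReal.ofReal (f x)) + (∫⁻ x, ENNReal.ofReal (g x)) ≤
      2 * (∫⁻ x, ENNReal.ofReal (h x)) := by
  rw [lintegral_eq_lintegral_meas_lt _ (.of_forall hf0) hf.aemeasurable,
    lintegral_eq_lintegral_meas_lt _ (.of_forall hg0) hg.aemeasurable,
    lintegral_eq_lintegral_meas_lt _ (.of_forall hh0) hh.aemeasurable,
    ← lintegral_const_mul' _ _ (by simp)]
  rw [← lintegral_add_left]
  swap
  · refine Antitone.measurable fun a b hab => measure_mono fun x hx => ?_
    exact lt_of_le_of_lt hab hx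
  refine setLIntegral_mono_ae' measurableSet_Ioi (.of_forall fun t ht => ?_)
  rcases lt_or_ge t 1 with ht1 | ht1
  · refine volume_add_le_two_mul (measurableSet_lt measurable_const hf)
      (measurableSet_lt measurable_const hg) (hf2 t ht1) (hg2 t ht1) fun x hx y hy => ?_
    have h1 : t ^ 2 < h ((1 / 2 : ℝ) • (x + y)) ^ 2 := by
      refine lt_of_lt_of_le ?_ (hfgh x y)
      rw [sq]
      exact mul_lt_mul'' hx hy (le_of_lt ht) (le_of_lt ht)
    exact lt_of_pow_lt_pow_left₀ 2 (hh0 _) h1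
  · have e1 : {a | t < f a} = ∅ := by
      ext a; simpa using (hf1 a).trans ht1
    have e2 : {a | t < g a} = ∅ := by
      ext a; simpa using (hg1 a).trans ht1
    simp [e1, e2]

theorem ENNReal.four_mul_mul_le_add_sq (a b : ℝ≥0∞) : 4 * (a * b) ≤ (a + b) ^ 2 := by
  rcases le_total a b with h | h <;> obtain ⟨c, rfl⟩ := exists_add_of_le h
  · calc 4 * (a * (a + c)) ≤ 4 * (a * (a + c)) + c ^ 2 := le_self_add
      _ = _ := by ring
  · calc 4 * ((b + c) * b) ≤ 4 * ((b + c) * b) + c ^ 2 := le_self_add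
      _ = _ := by ring

/-- Prékopa–Leindler on the line for bounded functions. -/
theorem lintegral_mul_lintegral_le_of_bddAbove {f g h : ℝ → ℝ} (hf : Measurable f)
    (hg : Measurable g) (hh : Measurable h) (hf0 : ∀ x, 0 ≤ f x) (hg0 : ∀ x, 0 ≤ g x)
    (hh0 : ∀ x, 0 ≤ h x) (hfb : BddAbove (Set.range f)) (hgb : BddAbove (Set.range g))
    (hfgh : ∀ x y, f x * g y ≤ h ((1 / 2 : ℝ) • (x + y)) ^ 2) :
    (∫⁻ x, ENNReal.ofReal (f x)) * (∫⁻ x, ENNReal.ofReal (g x)) ≤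
      (∫⁻ x, ENNReal.ofReal (h x)) ^ 2 := by
  set M := sSup (Set.range f) with hM
  set N := sSup (Set.range g) with hN
  have hfM : ∀ x, f x ≤ M := fun x => le_csSup hfb ⟨x, rfl⟩
  have hgN : ∀ x, g x ≤ N := fun x => le_csSup hgb ⟨x, rfl⟩
  rcases le_or_gt M 0 with hM0 | hM0
  · have : ∀ x, f x = 0 := fun x => le_antisymm ((hfM x).trans hM0) (hf0 x)
    simp [this]
  rcases le_or_gt N 0 with hN0 | hN0
  · have : ∀ x, g x = 0 := fun x => le_antisymm ((hgN x).trans hN0) (hg0 x)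
    simp [this]
  have hs : 0 < √(M * N) := Real.sqrt_pos.2 (mul_pos hM0 hN0)
  have key := lintegral_add_le_two_mul_of_forall_exists_lt (f := fun x => M⁻¹ * f x)
    (g := fun x => N⁻¹ * g x) (h := fun x => (√(M * N))⁻¹ * h x) (by fun_prop) (by fun_prop)
    (by fun_prop) (fun x => mul_nonneg (by positivity) (hf0 x))
    (fun x => mul_nonneg (by positivity) (hg0 x)) (fun x => mul_nonneg (by positivity) (hh0 x))
    (fun x => by rw [inv_mul_le_iff₀ hM0]; simpa using hfM x)
    (fun x => by rw [inv_mul_le_iff₀ hN0]; simpa using hgN x)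
    (fun t ht => by
      obtain ⟨_, ⟨x, rfl⟩, hx⟩ := exists_lt_of_lt_csSup (Set.range_nonempty f)
        (show M * t < M by nlinarith)
      exact ⟨x, by rwa [lt_inv_mul_iff₀ hM0]⟩)
    (fun t ht => by
      obtain ⟨_, ⟨x, rfl⟩, hx⟩ := exists_lt_of_lt_csSup (Set.range_nonempty g)
        (show N * t < N by nlinarith)
      exact ⟨x, by rwa [lt_inv_mul_iff₀ hN0]⟩)
    (fun x y => by
      rw [mul_pow, inv_pow, Real.sq_sqrt (by positivity)]
      calc M⁻¹ * f x * (N⁻¹ * g y) = (M * N)⁻¹ * (f x * g y) := by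
            rw [mul_inv]; ring
        _ ≤ _ := by gcongr; exact hfgh x y)
  simp only [ENNReal.ofReal_mul (inv_nonneg.2 hM0.le), ENNReal.ofReal_mul (inv_nonneg.2 hN0.le),
    ENNReal.ofReal_mul (inv_nonneg.2 hs.le)] at key
  rw [lintegral_const_mul' _ _ (by simp), lintegral_const_mul' _ _ (by simp),
    lintegral_const_mul' _ _ (by simp)] at key
  set F := ∫⁻ x, ENNReal.ofReal (f x)
  set G := ∫⁻ x, ENNReal.ofReal (g x)
  set H := ∫⁻ x, ENNReal.ofReal (h x)
  have h4 := (ENNReal.four_mul_mul_le_add_sq _ _).trans (pow_le_pow_left₀ (zero_le) key 2)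
  have e1 : ENNReal.ofReal M⁻¹ * ENNReal.ofReal N⁻¹ = ENNReal.ofReal (M * N)⁻¹ := by
    rw [← ENNReal.ofReal_mul (by positivity), mul_inv]
  have e2 : ENNReal.ofReal (√(M * N))⁻¹ ^ 2 = ENNReal.ofReal (M * N)⁻¹ := by
    rw [← ENNReal.ofReal_pow (by positivity), inv_pow, Real.sq_sqrt (by positivity)]
  have h5 : (4 * ENNReal.ofReal (M * N)⁻¹) * (F * G) ≤ (4 * ENNReal.ofReal (M * N)⁻¹) * H ^ 2 := by
    calc (4 * ENNReal.ofReal (M * N)⁻¹) * (F * G)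
        = 4 * (ENNReal.ofReal M⁻¹ * F * (ENNReal.ofReal N⁻¹ * G)) := by rw [← e1]; ring
      _ ≤ _ := h4
      _ = _ := by rw [← e2]; ring
  have hMN : 0 < (M * N)⁻¹ := by positivity
  refine (ENNReal.mul_le_mul_iff_right ?_ ?_).1 h5
  · exact mul_ne_zero (by norm_num) (by simpa using hMN)
  · exact ENNReal.mul_ne_top (by norm_num) (by simp)

theorem lintegral_eq_iSup_min_natCast {α : Type*} [MeasurableSpace α] (μ : Measure α)
    {f : α → ℝ≥0∞} (hf : Measurable f) :
    ∫⁻ x, f x ∂μ = ⨆ n : ℕ, ∫⁻ x, min (f x) n ∂μ := by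
  rw [← lintegral_iSup (fun n => hf.min measurable_const)
    (fun m n hmn x => min_le_min_left _ (by exact_mod_cast hmn))]
  congr with x
  have := inf_iSup_eq (f x) fun n : ℕ => (n : ℝ≥0∞)
  rwa [ENNReal.iSup_natCast, inf_top_eq] at this

theorem midpointPrekopaLeindler_real : MidpointPrekopaLeindler (volume : Measure ℝ) := by
  intro f g h hf hg hh hfgh
  have key : ∀ n : ℕ, (∫⁻ x, min (f x) n) * (∫⁻ x, min (g x) n) ≤ (∫⁻ x, h x) ^ 2 := by
    intro n
    have hfin : ∀ (k : ℝ → ℝ≥0∞) x, min (k x) (n : ℝ≥0∞) ≠ ⊤ := fun k x =>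
      ne_top_of_le_ne_top (ENNReal.natCast_ne_top n) (min_le_right _ _)
    have hb : ∀ (k : ℝ → ℝ≥0∞), BddAbove (Set.range fun x => (min (k x) (n : ℝ≥0∞)).toReal) := by
      rintro k
      refine ⟨n, ?_⟩
      rintro _ ⟨x, rfl⟩
      exact ENNReal.toReal_le_of_le_ofReal (by positivity) (by simp)
    have := lintegral_mul_lintegral_le_of_bddAbove (f := fun x => (min (f x) (n : ℝ≥0∞)).toReal)
      (g := fun x => (min (g x) (n : ℝ≥0∞)).toReal) (h := fun x => (min (h x) (n : ℝ≥0∞)).toReal)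
      (hf.min measurable_const).ennreal_toReal (hg.min measurable_const).ennreal_toReal
      (hh.min measurable_const).ennreal_toReal (fun _ => ENNReal.toReal_nonneg)
      (fun _ => ENNReal.toReal_nonneg) (fun _ => ENNReal.toReal_nonneg) (hb f) (hb g)
      (fun x y => by
        rw [← ENNReal.toReal_mul, ← ENNReal.toReal_pow]
        refine ENNReal.toReal_mono (ENNReal.pow_ne_top (hfin _ _)) ?_
        rcases le_total (h ((1 / 2 : ℝ) • (x + y))) n with h1 | h1
        · rw [min_eq_left h1]
          refine le_trans ?_ (hfgh x y)
          gcongr <;> exact min_le_left _ _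
        · rw [min_eq_right h1, sq]
          gcongr <;> exact min_le_right _ _)
    simp only [ENNReal.ofReal_toReal (hfin _ _)] at this
    refine this.trans ?_
    gcongr
    exact min_le_left _ _
  rw [lintegral_eq_iSup_min_natCast _ hf, lintegral_eq_iSup_min_natCast _ hg]
  simp only [ENNReal.iSup_mul, ENNReal.mul_iSup]
  refine iSup_le fun m => iSup_le fun n => le_trans ?_ (key (max m n))
  gcongr <;> simp

theorem midpointPrekopaLeindler_euclideanSpace (n : ℕ) :
    MidpointPrekopaLeindler (volume : Measure (EuclideanSpace ℝ (Fin n))) :=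
  (midpointPrekopaLeindler_real.pi n).of_measurePreserving
    (WithLp.linearEquiv 2 ℝ (Fin n → ℝ)).symm.toLinearMap (PiLp.volume_preserving_toLp (Fin n))

theorem MidpointPrekopaLeindler.measure_mul_measure_le {E : Type*} [AddCommGroup E] [Module ℝ E]
    [MeasurableSpace E] {μ : Measure E} (hμ : MidpointPrekopaLeindler μ) {A B S : Set E}
    (hA : MeasurableSet A) (hB : MeasurableSet B) (hS : MeasurableSet S)
    (h : ∀ x ∈ A, ∀ y ∈ B, (1 / 2 : ℝ) • (x + y) ∈ S) : μ A * μ B ≤ μ S ^ 2 := by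
  rw [← lintegral_indicator_one hA, ← lintegral_indicator_one hB, ← lintegral_indicator_one hS]
  refine hμ _ _ _ (measurable_one.indicator hA) (measurable_one.indicator hB)
    (measurable_one.indicator hS) fun x y => ?_
  by_cases hx : x ∈ A
  · by_cases hy : y ∈ B
    · rw [Set.indicator_of_mem hx, Set.indicator_of_mem hy, Set.indicator_of_mem (h x hx y hy)]
      simp
    · simp [hy]
  · simp [hx]

theorem Seminorm.half_smul_add_mem {E : Type*} [AddCommGroup E] [Module ℝ E] (p : Seminorm ℝ E)
    {x y : E} {u a : ℝ} (hx : p x ≤ a) (hy : 2 * u + a < p y) : u < p ((1 / 2 : ℝ) • (x + y)) := by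
  have h1 : p y ≤ p (x + y) + p x := by
    simpa using map_sub_le_add p (x + y) x
  rw [map_smul_eq_mul, Real.norm_of_nonneg (by norm_num)]
  linarith

/-- Concentration of seminorms on a convex set, in the spirit of Borell's lemma. -/
theorem MidpointPrekopaLeindler.measureReal_mul_le {E : Type*} [AddCommGroup E] [Module ℝ E]
    [MeasurableSpace E] {μ : Measure E} (hμ : MidpointPrekopaLeindler μ) {D : Set E}
    (hD : MeasurableSet D) (hDc : Convex ℝ D) [IsProbabilityMeasure (μ.restrict D)]
    (p : Seminorm ℝ E) (hp : Measurable p) (u a : ℝ) :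
    (μ.restrict D).real {x | p x ≤ a} * (μ.restrict D).real {x | 2 * u + a < p x} ≤
      (μ.restrict D).real {x | u < p x} ^ 2 := by
  have m1 : MeasurableSet {x | p x ≤ a} := measurableSet_le hp measurable_const
  have m2 : MeasurableSet {x | 2 * u + a < p x} := measurableSet_lt measurable_const hp
  have m3 : MeasurableSet {x | u < p x} := measurableSet_lt measurable_const hp
  have h := hμ.measure_mul_measure_le (m1.inter hD) (m2.inter hD) (m3.inter hD)
    (fun x hx y hy => ⟨p.half_smul_add_mem hx.1 hy.1, by
      rw [smul_add]
      exact hDc hx.2 hy.2 (by norm_num) (by norm_num) (by norm_num)⟩)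
  rw [← Measure.restrict_apply m1, ← Measure.restrict_apply m2, ← Measure.restrict_apply m3] at h
  simp only [Measure.real, ← ENNReal.toReal_mul, ← ENNReal.toReal_pow]
  exact ENNReal.toReal_mono (by finiteness) h

theorem MidpointPrekopaLeindler.eighteen_mul_measureReal_le {E : Type*} [AddCommGroup E]
    [Module ℝ E] [MeasurableSpace E] {μ : Measure E} (hμ : MidpointPrekopaLeindler μ) {D : Set E}
    (hD : MeasurableSet D) (hDc : Convex ℝ D) [IsProbabilityMeasure (μ.restrict D)]
    (p : Seminorm ℝ E) (hp : Measurable p) (hpi : Integrable p (μ.restrict D)) {a u : ℝ}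
    (ha : 0 < a) (hpa : 19 * ∫ x in D, p x ∂μ ≤ a) (hu : a ≤ u) :
    18 * (μ.restrict D).real {x | 3 * u < p x} ≤ (μ.restrict D).real {x | u < p x} := by
  set ν := μ.restrict D
  have h1 : a * ν.real {x | a ≤ p x} ≤ ∫ x, p x ∂ν :=
    mul_meas_ge_le_integral_of_nonneg (.of_forall fun x => apply_nonneg p x) hpi a
  have h2 : ν.real {x | a < p x} ≤ ν.real {x | a ≤ p x} :=
    measureReal_mono fun x (hx : a < p x) => hx.le
  have h3 : ν.real {x | a < p x} = 1 - ν.real {x | p x ≤ a} := by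
    rw [← probReal_compl_eq_one_sub (measurableSet_le hp measurable_const)]
    congr 1
    ext x
    simp
  have h4 : ν.real {x | u < p x} ≤ ν.real {x | a < p x} :=
    measureReal_mono fun x hx => lt_of_le_of_lt hu hx
  have h5 : ν.real {x | 3 * u < p x} ≤ ν.real {x | 2 * u + a < p x} :=
    measureReal_mono fun x (hx : 3 * u < p x) => show 2 * u + a < p x by linarith
  have h6 := hμ.measureReal_mul_le hD hDc p hp u a
  have h7 : ν.real {x | a ≤ p x} ≤ 1 / 19 := by
    by_contra hcon
    push Not at hcon
    nlinarith
  have h8 : (0 : ℝ) ≤ ν.real {x | 3 * u < p x} := measureReal_nonneg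
  have h9 : (0 : ℝ) ≤ ν.real {x | u < p x} := measureReal_nonneg
  have h10 : (18 / 19) * ν.real {x | 3 * u < p x} ≤
      ν.real {x | p x ≤ a} * ν.real {x | 2 * u + a < p x} :=
    mul_le_mul (by linarith) h5 h8 (by linarith)
  have h11 : ν.real {x | u < p x} ^ 2 ≤ (1 / 19) * ν.real {x | u < p x} := by
    rw [sq]
    exact mul_le_mul_of_nonneg_right (by linarith) h9
  change ν.real {x | p x ≤ a} * ν.real {x | 2 * u + a < p x} ≤ ν.real {x | u < p x} ^ 2 at h6
  linarith

theorem MidpointPrekopaLeindler.integral_sq_le_of_le {E : Type*} [AddCommGroup E]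
    [Module ℝ E] [MeasurableSpace E] {μ : Measure E} (hμ : MidpointPrekopaLeindler μ) {D : Set E}
    (hD : MeasurableSet D) (hDc : Convex ℝ D) [IsProbabilityMeasure (μ.restrict D)]
    (p : Seminorm ℝ E) (hp : Measurable p) (hpi : MemLp p 2 (μ.restrict D)) {a : ℝ}
    (ha : 0 < a) (hpa : 19 * ∫ x in D, p x ∂μ ≤ a) :
    ∫ x in D, p x ^ 2 ∂μ ≤ 18 * a ^ 2 := by
  set ν := μ.restrict D with hν
  have hpi1 : Integrable p ν := hpi.integrable (by norm_num)
  have key : ∀ w : ℝ, 0 < w → 18 * ν {x | w < p x ^ 2 / 9} ≤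
      (Set.Ioo 0 (a ^ 2)).indicator (fun _ => (18 : ℝ≥0∞)) w + ν {x | w < p x ^ 2} := by
    intro w hw
    rcases lt_or_ge w (a ^ 2) with hwa | hwa
    · rw [Set.indicator_of_mem (show w ∈ Set.Ioo 0 (a ^ 2) from ⟨hw, hwa⟩)]
      refine le_trans ?_ le_self_add
      calc 18 * ν {x | w < p x ^ 2 / 9} ≤ 18 * 1 := by gcongr; exact prob_le_one
        _ = 18 := mul_one _
    · have h := hμ.eighteen_mul_measureReal_le hD hDc p hp hpi1 ha hpa (Real.le_sqrt_of_sq_le hwa)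
      have e1 : {x | w < p x ^ 2 / 9} = {x | 3 * √w < p x} := by
        ext x
        have := Real.sqrt_lt hw.le (div_nonneg (apply_nonneg p x) (by norm_num : (0 : ℝ) ≤ 3))
        rw [lt_div_iff₀' (by norm_num), div_pow] at this
        norm_num at this
        exact this.symm
      have e2 : {x | w < p x ^ 2} = {x | √w < p x} := by
        ext x
        exact (Real.sqrt_lt hw.le (apply_nonneg p x)).symm
      rw [e1, e2]
      refine le_trans ?_ le_add_self
      rw [← ENNReal.toReal_le_toReal (by finiteness) (by finiteness), ENNReal.toReal_mul]
      exact h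
  have hm : Measurable fun x => p x ^ 2 := by fun_prop
  have hl := lintegral_mono_ae (μ := volume.restrict (Set.Ioi (0 : ℝ)))
    ((ae_restrict_iff' measurableSet_Ioi).2 (.of_forall key))
  rw [lintegral_const_mul' _ _ (by simp), lintegral_add_left
    (measurable_const.indicator measurableSet_Ioo),
    ← lintegral_eq_lintegral_meas_lt ν (.of_forall fun x => by positivity) hm.aemeasurable,
    ← lintegral_eq_lintegral_meas_lt ν (.of_forall fun x => by positivity)
      (hm.div_const 9).aemeasurable, lintegral_indicator measurableSet_Ioo, lintegral_const,
    Measure.restrict_restrict measurableSet_Ioo,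
    Set.inter_eq_left.2 (fun x hx => hx.1), Measure.restrict_apply_univ, Real.volume_Ioo,
    ← ofReal_integral_eq_lintegral_ofReal hpi.integrable_sq (.of_forall fun x => by positivity),
    ← ofReal_integral_eq_lintegral_ofReal (hpi.integrable_sq.div_const 9)
      (.of_forall fun x => by positivity), integral_div] at hl
  have hX : 0 ≤ ∫ x, p x ^ 2 ∂ν := integral_nonneg fun x => by positivity
  rw [← ENNReal.toReal_le_toReal (by finiteness) (by finiteness), ENNReal.toReal_add (by finiteness)
    (by finiteness), ENNReal.toReal_mul, ENNReal.toReal_mul, ENNReal.toReal_ofReal (by positivity),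
    ENNReal.toReal_ofReal (by simpa using sq_nonneg a), ENNReal.toReal_ofReal hX] at hl
  norm_num at hl
  linarith

/-- Reverse Hölder inequality for seminorms on convex sets. -/
theorem MidpointPrekopaLeindler.integral_sq_le {E : Type*} [AddCommGroup E]
    [Module ℝ E] [MeasurableSpace E] {μ : Measure E} (hμ : MidpointPrekopaLeindler μ) {D : Set E}
    (hD : MeasurableSet D) (hDc : Convex ℝ D) [IsProbabilityMeasure (μ.restrict D)]
    (p : Seminorm ℝ E) (hp : Measurable p) (hpi : MemLp p 2 (μ.restrict D)) :
    ∫ x in D, p x ^ 2 ∂μ ≤ (90 * ∫ x in D, p x ∂μ) ^ 2 := by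
  set I := ∫ x in D, p x ∂μ
  have hI : 0 ≤ I := integral_nonneg fun x => apply_nonneg p x
  have h : ∀ᶠ a in nhdsWithin (19 * I) (Set.Ioi (19 * I)), ∫ x in D, p x ^ 2 ∂μ ≤ 18 * a ^ 2 := by
    filter_upwards [self_mem_nhdsWithin] with a ha
    have ha' : 19 * I < a := ha
    exact hμ.integral_sq_le_of_le hD hDc p hp hpi (by linarith) ha'.le
  have ht : Filter.Tendsto (fun a : ℝ => 18 * a ^ 2) (nhdsWithin (19 * I) (Set.Ioi (19 * I)))
      (nhds (18 * (19 * I) ^ 2)) :=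
    (Continuous.tendsto (by fun_prop) _).mono_left nhdsWithin_le_nhds
  have := ge_of_tendsto ht h
  nlinarith [sq_nonneg I]

theorem Seminorm.memLp_sum {E Ω : Type*} [AddCommGroup E] [Module ℝ E]
    [MeasurableSpace E] [MeasurableAdd₂ E] [MeasurableSpace Ω] {μ : Measure Ω} (p : Seminorm ℝ E)
    (hp : Measurable p) {N : ℕ} {f : Fin N → Ω → E} (hf : ∀ k, Measurable (f k)) {q : ℝ≥0∞}
    (h : ∀ k, MemLp (fun x => p (f k x)) q μ) : MemLp (fun x => p (∑ k, f k x)) q μ := by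
  refine (memLp_finsetSum Finset.univ fun k _ => h k).mono'
    (hp.comp (Finset.univ.measurable_fun_sum fun k _ => hf k)).aestronglyMeasurable
    (.of_forall fun x => ?_)
  rw [Real.norm_of_nonneg (apply_nonneg p _)]
  exact Finset.le_sum_of_subadditive p (map_zero p).le (map_add_le_add p) Finset.univ fun k => f k x

/-- The type-2 inequality extends from signs to independent symmetric random vectors. -/
theorem Seminorm.integral_sq_sum_le_of_typeTwo {E : Type*} [AddCommGroup E] [Module ℝ E]
    [MeasurableSpace E] [MeasurableAdd₂ E] (p : Seminorm ℝ E) (hp : Measurable p)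
    {T : ℝ} {N : ℕ}
    (hT : ∀ x : Fin N → E, (2 ^ N : ℝ)⁻¹ *
        ∑ ε : Fin N → Bool, p (∑ i, (if ε i then (1 : ℝ) else -1) • x i) ^ 2 ≤
      T ^ 2 * ∑ i, p (x i) ^ 2)
    {F : Type*} [AddGroup F] [MeasurableSpace F] (ν : Measure F) [IsProbabilityMeasure ν]
    (hν : MeasurePreserving (fun x => -x) ν ν) (A : Fin N → F → E) (hA : ∀ k, Measurable (A k))
    (hodd : ∀ k x, A k (-x) = -A k x) (hLp : ∀ k, MemLp (fun x => p (A k x)) 2 ν) :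
    ∫ x, p (∑ k, A k (x k)) ^ 2 ∂(Measure.pi fun _ : Fin N => ν) ≤
      T ^ 2 * ∑ k, ∫ x, p (A k x) ^ 2 ∂ν := by
  set P := Measure.pi fun _ : Fin N => ν
  have hev : ∀ k, MeasurePreserving (Function.eval k) P ν := measurePreserving_eval _
  have hLp' : ∀ k, MemLp (fun x : Fin N → F => p (A k (x k))) 2 P := fun k =>
    (hLp k).comp_measurePreserving (hev k)
  have hflip : ∀ ε : Fin N → Bool,
      MeasurePreserving (fun (x : Fin N → F) k => if ε k then x k else - x k) P P := fun ε =>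
    measurePreserving_pi (fun _ => ν) (fun _ => ν)
      (f := fun k y => if ε k then y else -y) fun k => by
        cases ε k
        · simpa using hν
        · exact MeasurePreserving.id ν
  have hm : Measurable fun x : Fin N → F => p (∑ k, A k (x k)) := by fun_prop
  have hsum : MemLp (fun x : Fin N → F => p (∑ k, A k (x k))) 2 P :=
    p.memLp_sum hp (fun k => (hA k).comp (measurable_pi_apply k)) hLp'
  have hεeq : ∀ (ε : Fin N → Bool) (x : Fin N → F),
      ∑ k, A k (if ε k then x k else - x k) = ∑ k, (if ε k then (1 : ℝ) else -1) • A k (x k) := by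
    intro ε x
    refine Finset.sum_congr rfl fun k _ => ?_
    cases ε k <;> simp [hodd]
  have hsumε : ∀ ε : Fin N → Bool,
      MemLp (fun x : Fin N → F => p (∑ k, (if ε k then (1 : ℝ) else -1) • A k (x k))) 2 P := by
    intro ε
    simp only [← hεeq]
    exact hsum.comp_measurePreserving (hflip ε)
  have hint : ∀ ε : Fin N → Bool,
      ∫ x, p (∑ k, (if ε k then (1 : ℝ) else -1) • A k (x k)) ^ 2 ∂P =
        ∫ x, p (∑ k, A k (x k)) ^ 2 ∂P := by
    intro ε
    conv_rhs => rw [← (hflip ε).map_eq]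
    rw [integral_map (hflip ε).measurable.aemeasurable (hm.pow_const 2).aestronglyMeasurable]
    simp only [hεeq]
  calc ∫ x, p (∑ k, A k (x k)) ^ 2 ∂P
      = (2 ^ N : ℝ)⁻¹ * ∑ ε : Fin N → Bool,
          ∫ x, p (∑ k, (if ε k then (1 : ℝ) else -1) • A k (x k)) ^ 2 ∂P := by
        simp only [hint]
        simp
    _ = ∫ x, (2 ^ N : ℝ)⁻¹ * ∑ ε : Fin N → Bool,
          p (∑ k, (if ε k then (1 : ℝ) else -1) • A k (x k)) ^ 2 ∂P := by
        rw [integral_const_mul, integral_finsetSum _ fun ε _ => (hsumε ε).integrable_sq]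
    _ ≤ ∫ x, T ^ 2 * ∑ k, p (A k (x k)) ^ 2 ∂P := by
        refine integral_mono ?_ ?_ fun x => hT fun k => A k (x k)
        · exact (integrable_finsetSum _ fun ε _ => (hsumε ε).integrable_sq).const_mul _
        · exact (integrable_finsetSum _ fun k _ => (hLp' k).integrable_sq).const_mul _
    _ = T ^ 2 * ∑ k, ∫ x, p (A k x) ^ 2 ∂ν := by
        rw [integral_const_mul, integral_finsetSum _ fun k _ => (hLp' k).integrable_sq]
        congr 1
        refine Finset.sum_congr rfl fun k _ => ?_
        exact integral_comp_eval (μ := fun _ : Fin N => ν) (f := fun y => p (A k y) ^ 2)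
          ((hp.comp (hA k)).pow_const 2).aestronglyMeasurable

section Gaussian

open ProbabilityTheory

theorem integral_eq_average_sphere_mul {n : ℕ} [NeZero n] (φ : ℝ → ℝ)
    (p : Seminorm ℝ (EuclideanSpace ℝ (Fin n))) :
    ∫ x, p x * φ ‖x‖ = (⨍ ξ, p (ξ : EuclideanSpace ℝ (Fin n))
      ∂((volume : Measure (EuclideanSpace ℝ (Fin n))).toSphere)) *
        ∫ x : EuclideanSpace ℝ (Fin n), ‖x‖ * φ ‖x‖ := by
  set E := EuclideanSpace ℝ (Fin n)
  set μ : Measure E := volume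
  have polar : ∀ q : E → ℝ, (∀ (r : ℝ) (x : E), 0 ≤ r → q (r • x) = r * q x) →
      ∫ x, q x * φ ‖x‖ ∂μ = (∫ ξ, q (ξ : E) ∂μ.toSphere) *
        ∫ r : Set.Ioi (0 : ℝ), r * φ r ∂Measure.volumeIoiPow (Module.finrank ℝ E - 1) := by
    intro q hq
    rw [← integral_prod_mul (fun ξ : Metric.sphere (0 : E) 1 => q ξ)
        (fun r : Set.Ioi (0 : ℝ) => r * φ r),
      ← μ.measurePreserving_homeomorphUnitSphereProd.integral_comp
        (homeomorphUnitSphereProd E).measurableEmbedding,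
      ← restrict_compl_singleton (μ := μ) (0 : E),
      ← integral_subtype_comap (measurableSet_singleton (0 : E)).compl,
      restrict_compl_singleton]
    refine integral_congr_ae (.of_forall fun x => ?_)
    have hx : ‖(x : E)‖ ≠ 0 := norm_ne_zero_iff.2 x.2
    simp only [homeomorphUnitSphereProd_apply_snd_coe, homeomorphUnitSphereProd_apply_fst_coe]
    rw [hq _ _ (by positivity)]
    field_simp
  have h1 := polar p fun r x hr => by rw [map_smul_eq_mul, Real.norm_of_nonneg hr]
  have h2 := polar (fun x => ‖x‖) fun r x hr => by rw [norm_smul, Real.norm_of_nonneg hr]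
  rw [h1, h2, average_eq, smul_eq_mul]
  have h0 : μ.toSphere.real Set.univ ≠ 0 := by
    rw [Measure.real, ENNReal.toReal_ne_zero]
    exact ⟨(Measure.measure_univ_ne_zero.2 μ.toSphere_ne_zero), measure_ne_top _ _⟩
  simp only [norm_eq_of_mem_sphere, integral_const, smul_eq_mul, mul_one]
  field_simp

theorem exists_stdGaussian_eq_withDensity (n : ℕ) :
    ∃ c : ℝ, 0 ≤ c ∧ stdGaussian (EuclideanSpace ℝ (Fin n)) =
      volume.withDensity fun x => ENNReal.ofReal (c * Real.exp (-(1 / 2) * ‖x‖ ^ 2)) := by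
  set E := EuclideanSpace ℝ (Fin n)
  set c : ℝ := ((2 * π) ^ ((n : ℝ) / 2))⁻¹ with hc
  have hc0 : 0 < c := by positivity
  refine ⟨c, hc0.le, ?_⟩
  have hint : Integrable fun x : E => c * Real.exp (-(1 / 2) * ‖x‖ ^ 2) := by
    have := (GaussianFourier.integrable_cexp_neg_mul_sq_norm_add (b := 1 / 2) (V := E)
      (by norm_num) 0 0).re.const_mul c
    convert this using 2 with x
    simp only [zero_mul, add_zero]
    rw [← Complex.ofReal_re (Real.exp _)]
    push_cast
    rfl
  have : IsFiniteMeasure (volume.withDensity fun x : E =>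
      ENNReal.ofReal (c * Real.exp (-(1 / 2) * ‖x‖ ^ 2))) :=
    isFiniteMeasure_withDensity_ofReal hint.2
  refine Measure.ext_of_charFun (funext fun ξ => ?_)
  rw [charFun_stdGaussian, charFun_apply,
    integral_withDensity_eq_integral_toReal_smul (by fun_prop) (by simp)]
  have h := GaussianFourier.integral_cexp_neg_mul_sq_norm_add (b := 1 / 2) (V := E)
    (by norm_num) Complex.I ξ
  have e : ∀ x : E, (ENNReal.ofReal (c * Real.exp (-(1 / 2) * ‖x‖ ^ 2))).toReal •
      Complex.exp (⟪x, ξ⟫ * Complex.I) =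
      c * Complex.exp (-(1 / 2) * ‖x‖ ^ 2 + Complex.I * ⟪ξ, x⟫) := by
    intro x
    rw [ENNReal.toReal_ofReal (by positivity), Complex.real_smul, Complex.exp_add,
      real_inner_comm]
    push_cast
    ring_nf
  simp only [e]
  rw [integral_const_mul, h, hc, Complex.I_sq]
  have hπ : (π / (1 / 2) : ℂ) = ((2 * π : ℝ) : ℂ) := by push_cast; ring
  have hf : ((Module.finrank ℝ E : ℕ) / 2 : ℂ) = ((n / 2 : ℝ) : ℂ) := by
    rw [finrank_euclideanSpace_fin]; push_cast; ring
  rw [hπ, hf, ← Complex.ofReal_cpow (by positivity), Complex.ofReal_inv, ← mul_assoc,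
    inv_mul_cancel₀ (by exact_mod_cast (by positivity : (2 * π) ^ ((n : ℝ) / 2) ≠ 0)), one_mul]
  ring_nf

theorem integral_stdGaussian_eq_average_sphere_mul {n : ℕ} [NeZero n]
    (p : Seminorm ℝ (EuclideanSpace ℝ (Fin n))) :
    ∫ x, p x ∂stdGaussian (EuclideanSpace ℝ (Fin n)) =
      (⨍ ξ, p (ξ : EuclideanSpace ℝ (Fin n))
        ∂((volume : Measure (EuclideanSpace ℝ (Fin n))).toSphere)) *
        ∫ x, ‖x‖ ∂stdGaussian (EuclideanSpace ℝ (Fin n)) := by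
  obtain ⟨c, hc, h⟩ := exists_stdGaussian_eq_withDensity n
  rw [h, integral_withDensity_eq_integral_toReal_smul (by fun_prop) (by simp),
    integral_withDensity_eq_integral_toReal_smul (by fun_prop) (by simp)]
  have := integral_eq_average_sphere_mul (fun r => c * Real.exp (-(1 / 2) * r ^ 2)) p
  simpa [ENNReal.toReal_ofReal, hc, Real.exp_nonneg, mul_nonneg, mul_comm] using this

theorem integral_abs_gaussianReal_pos : 0 < ∫ x, |x| ∂gaussianReal 0 1 := by
  have hi : Integrable (fun x : ℝ => |x|) (gaussianReal 0 1) :=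
    ((memLp_id_gaussianReal 1).integrable (by simp)).abs
  rw [integral_pos_iff_support_of_nonneg (fun x => abs_nonneg x) hi]
  have : Function.support (fun x : ℝ => |x|) = {0}ᶜ := by ext; simp
  have h0 := nullSingletonClass_gaussianReal (μ := 0) (v := 1) (by simp)
  rw [this, prob_compl_eq_one_sub (measurableSet_singleton _)]
  simp

theorem sqrt_mul_le_integral_norm_stdGaussian (n : ℕ) :
    √n * ∫ x, |x| ∂gaussianReal 0 1 ≤ ∫ x, ‖x‖ ∂stdGaussian (EuclideanSpace ℝ (Fin n)) := by
  rcases n.eq_zero_or_pos with rfl | hn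
  · simpa using integral_nonneg fun x => norm_nonneg x
  have hn' : 0 < √(n : ℝ) := by positivity
  have hi : Integrable (fun x : ℝ => |x|) (gaussianReal 0 1) :=
    ((memLp_id_gaussianReal 1).integrable (by simp)).abs
  have hev : ∀ i : Fin n, Integrable (fun x : Fin n → ℝ => |x i|)
      (Measure.pi fun _ : Fin n => gaussianReal 0 1) := fun i =>
    (measurePreserving_eval (fun _ : Fin n => gaussianReal 0 1) i).integrable_comp_of_integrable hi
  have hstd : Integrable (fun x => ‖x‖) (stdGaussian (EuclideanSpace ℝ (Fin n))) :=
    IsGaussian.integrable_id.norm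
  rw [← map_pi_eq_stdGaussian] at hstd ⊢
  rw [integrable_map_measure (by fun_prop) (by fun_prop)] at hstd
  rw [integral_map (by fun_prop) (by fun_prop)]
  have key : ∀ x : Fin n → ℝ, (√n)⁻¹ * ∑ i, |x i| ≤ ‖WithLp.toLp 2 x‖ := by
    intro x
    rw [inv_mul_le_iff₀ hn', EuclideanSpace.norm_eq, ← Real.sqrt_mul (by positivity)]
    refine Real.le_sqrt_of_sq_le ?_
    simpa using sq_sum_le_card_mul_sum_sq (s := Finset.univ) (f := fun i => |x i|)
  have h := integral_mono ((integrable_finsetSum _ fun i _ => hev i).const_mul _) hstd key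
  refine le_trans (le_of_eq ?_) h
  rw [integral_const_mul, integral_finsetSum _ fun i _ => hev i]
  have e : ∀ i : Fin n, ∫ x, |x i| ∂(Measure.pi fun _ : Fin n => gaussianReal 0 1) =
      ∫ x, |x| ∂gaussianReal 0 1 := fun i =>
    integral_comp_eval (μ := fun _ : Fin n => gaussianReal 0 1) (f := fun y : ℝ => |y|)
      (by fun_prop)
  simp only [e, Finset.sum_const, Finset.card_univ, Fintype.card_fin, nsmul_eq_mul]
  rw [← mul_assoc, inv_mul_eq_div, Real.div_sqrt]

theorem map_pi_sum_smul_eq_map_smul_stdGaussian {n N : ℕ} (v : Fin N → EuclideanSpace ℝ (Fin n))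
    (a : ℝ) (hv : ∀ ξ, ∑ k, ⟪v k, ξ⟫ ^ 2 = a ^ 2 * ‖ξ‖ ^ 2) :
    (Measure.pi fun _ : Fin N => gaussianReal 0 1).map (fun g => ∑ k, g k • v k) =
      (stdGaussian (EuclideanSpace ℝ (Fin n))).map (fun x => a • x) := by
  have := Measure.isFiniteMeasure_map (Measure.pi fun _ : Fin N => gaussianReal 0 1)
    (fun g => ∑ k, g k • v k)
  refine Measure.ext_of_charFun (funext fun ξ => ?_)
  have hm : Measurable fun g : Fin N → ℝ => ∑ k, g k • v k := by fun_prop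
  rw [charFun_map_smul, charFun_stdGaussian, charFun_apply, integral_map hm.aemeasurable
    (by fun_prop)]
  set w : EuclideanSpace ℝ (Fin N) := WithLp.toLp 2 fun k => ⟪v k, ξ⟫
  have h := charFun_stdGaussian w
  rw [← map_pi_eq_stdGaussian, charFun_apply, integral_map (by fun_prop) (by fun_prop)] at h
  have e : ∀ g : Fin N → ℝ, ⟪∑ k, g k • v k, ξ⟫ = ⟪WithLp.toLp 2 g, w⟫ := by
    intro g
    simp [sum_inner, inner_smul_left, PiLp.inner_apply, w, mul_comm]
  simp only [e]
  rw [h]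
  have e2 : ‖w‖ ^ 2 = ‖a • ξ‖ ^ 2 := by
    rw [EuclideanSpace.norm_sq_eq, norm_smul, mul_pow, Real.norm_eq_abs, sq_abs, ← hv]
    simp [w]
  norm_cast
  rw [e2]

end Gaussian

/-- In finite dimension the convex hull of a compact set is compact. -/
theorem IsCompact.isCompact_convexHull {E : Type*} [NormedAddCommGroup E] [NormedSpace ℝ E]
    [FiniteDimensional ℝ E] {s : Set E} (hs : IsCompact s) : IsCompact (convexHull ℝ s) := by
  have h : convexHull ℝ s = ⋃ k ∈ Finset.range (Module.finrank ℝ E + 2),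
      (fun q : (Fin k → ℝ) × (Fin k → E) => ∑ i, q.1 i • q.2 i) ''
        (stdSimplex ℝ (Fin k) ×ˢ Set.univ.pi fun _ => s) := by
    refine Set.Subset.antisymm (fun x hx => ?_) ?_
    · obtain ⟨ι, _, z, w, hz, hi, hw, hw1, rfl⟩ := eq_pos_convex_span_of_mem_convexHull hx
      simp only [Set.mem_iUnion, Finset.mem_range]
      refine ⟨Fintype.card ι, ?_, ?_⟩
      · exact Nat.lt_succ_of_le (hi.card_le_finrank_succ.trans
          (Nat.succ_le_succ (Submodule.finrank_le _)))
      let e := (Fintype.equivFin ι).symm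
      refine ⟨(w ∘ e, z ∘ e), ⟨⟨fun i => (hw _).le, ?_⟩, fun i _ => hz ⟨_, rfl⟩⟩, ?_⟩
      · rw [← hw1]
        exact e.sum_comp w
      · exact e.sum_comp fun i => w i • z i
    · simp only [Set.iUnion_subset_iff]
      rintro k - _ ⟨⟨w, z⟩, ⟨hw, hz⟩, rfl⟩
      exact mem_convexHull_of_exists_fintype w z hw.1 hw.2 (fun i => hz i (Set.mem_univ i)) rfl
  rw [h]
  refine (Finset.range _).isCompact_biUnion fun k _ => ?_
  exact ((isCompact_stdSimplex ℝ (Fin k)).prod (isCompact_univ_pi fun _ => hs)).image (by fun_prop)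

/-- An exact quadrature formula for a continuous vector-valued function. -/
theorem exists_sum_smul_eq_integral {X F : Type*} [TopologicalSpace X] [MeasurableSpace X]
    [NormedAddCommGroup F] [NormedSpace ℝ F] [FiniteDimensional ℝ F] {μ : Measure X}
    {D : Set X} (hD : IsCompact D) (hDm : MeasurableSet D) [IsProbabilityMeasure (μ.restrict D)]
    {f : X → F} (hf : Continuous f) (hfi : IntegrableOn f D μ) :
    ∃ (N : ℕ) (w : Fin N → ℝ) (z : Fin N → X), (∀ i, 0 ≤ w i) ∧
      ∑ i, w i • f (z i) = ∫ x in D, f x ∂μ := by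
  have h : (∫ x in D, f x ∂μ) ∈ convexHull ℝ (f '' D) :=
    (convex_convexHull ℝ _).integral_mem (hD.image hf).isCompact_convexHull.isClosed
      ((ae_restrict_mem hDm).mono fun x hx => subset_convexHull ℝ _ ⟨x, hx, rfl⟩) hfi
  obtain ⟨ι, _, w, y, hw, -, hy, hsum⟩ := mem_convexHull_iff_exists_fintype.1 h
  choose z _ hz using hy
  let e := (Fintype.equivFin ι).symm
  refine ⟨Fintype.card ι, w ∘ e, z ∘ e, fun i => hw _, ?_⟩
  rw [← hsum, ← e.sum_comp]
  simp [hz]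

section SecondMoments

open ProbabilityTheory

theorem integral_le_sqrt_integral_sq {Ω : Type*} [MeasurableSpace Ω] {μ : Measure Ω}
    [IsProbabilityMeasure μ] {f : Ω → ℝ} (hf : MemLp f 2 μ) :
    ∫ x, f x ∂μ ≤ √(∫ x, f x ^ 2 ∂μ) := by
  refine Real.le_sqrt_of_sq_le ?_
  have h := variance_nonneg f μ
  rw [variance_eq_sub hf] at h
  simpa using h

theorem integral_sq_sum_pi_eq {F : Type*} [MeasurableSpace F] (ν : Measure F)
    [IsProbabilityMeasure ν] {N : ℕ} {f : Fin N → F → ℝ} (hf : ∀ k, MemLp (f k) 2 ν)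
    (h0 : ∀ k, ∫ x, f k x ∂ν = 0) :
    ∫ x, (∑ k, f k (x k)) ^ 2 ∂(Measure.pi fun _ : Fin N => ν) = ∑ k, ∫ x, f k x ^ 2 ∂ν := by
  set P := Measure.pi fun _ : Fin N => ν
  have hLp : ∀ k, MemLp (fun x : Fin N → F => f k (x k)) 2 P := fun k =>
    (hf k).comp_measurePreserving (measurePreserving_eval _ k)
  have hzero : ∀ k, ∫ x, f k (x k) ∂P = 0 := fun k =>
    (integral_comp_eval (μ := fun _ : Fin N => ν) (hf k).aestronglyMeasurable).trans (h0 k)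
  have hind : iIndepFun (fun k (x : Fin N → F) => f k (x k)) P :=
    iIndepFun_pi fun k => (hf k).aemeasurable
  have h := IndepFun.variance_sum (s := Finset.univ) (fun k _ => hLp k)
    fun i _ j _ hij => hind.indepFun hij
  rw [variance_of_integral_eq_zero (Finset.aemeasurable_sum _ fun k _ => (hLp k).aemeasurable)]
    at h
  · simp only [Finset.sum_apply] at h
    rw [h]
    refine Finset.sum_congr rfl fun k _ => ?_
    rw [variance_of_integral_eq_zero (hLp k).aemeasurable (hzero k)]
    exact integral_comp_eval (μ := fun _ : Fin N => ν) (f := fun y => f k y ^ 2)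
      ((hf k).aestronglyMeasurable.pow 2)
  · simp only [Finset.sum_apply]
    rw [integral_finsetSum _ fun k _ => (hLp k).integrable (by simp)]
    simp [hzero]

theorem Continuous.memLp_two_restrict {X : Type*} [TopologicalSpace X] [T2Space X]
    [SecondCountableTopology X] [MeasurableSpace X] [BorelSpace X] {μ : Measure X}
    [IsFiniteMeasureOnCompacts μ] {D : Set X} (hD : IsCompact D) {f : X → ℝ} (hf : Continuous f) :
    MemLp f 2 (μ.restrict D) :=
  (memLp_two_iff_integrable_sq hf.aestronglyMeasurable).2
    ((hf.pow 2).continuousOn.integrableOn_compact hD)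

end SecondMoments

section Comparison

open ProbabilityTheory

/-- Finitely many vectors carry the covariance and the second `p`-moment of a continuous
random vector. -/
theorem exists_sum_inner_sq_eq_integral {X E : Type*} [TopologicalSpace X] [T2Space X]
    [SecondCountableTopology X] [MeasurableSpace X] [BorelSpace X] [NormedAddCommGroup E]
    [InnerProductSpace ℝ E] [FiniteDimensional ℝ E] {μ : Measure X} [IsFiniteMeasureOnCompacts μ]
    {D : Set X} (hD : IsCompact D) [IsProbabilityMeasure (μ.restrict D)]
    {Y : X → E} (hY : Continuous Y) (p : Seminorm ℝ E) (hp : Continuous p) :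
    ∃ (N : ℕ) (v : Fin N → E), (∀ ξ, ∑ k, ⟪v k, ξ⟫ ^ 2 = ∫ x in D, ⟪Y x, ξ⟫ ^ 2 ∂μ) ∧
      ∑ k, p (v k) ^ 2 = ∫ x in D, p (Y x) ^ 2 ∂μ := by
  let f : X → (E →L[ℝ] E) × ℝ := fun x => ((innerSL ℝ (Y x)).smulRight (Y x), p (Y x) ^ 2)
  have hf : Continuous f := by
    refine Continuous.prodMk ?_ (by fun_prop)
    exact (ContinuousLinearMap.smulRightL ℝ E E).continuous₂.comp
      (((innerSL ℝ).continuous.comp hY).prodMk hY)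
  have hfi : IntegrableOn f D μ := hf.continuousOn.integrableOn_compact hD
  obtain ⟨N, w, z, hw, hsum⟩ := exists_sum_smul_eq_integral hD hD.measurableSet hf hfi
  have key : ∀ ℓ : (E →L[ℝ] E) × ℝ →L[ℝ] ℝ, ∑ i, w i * ℓ (f (z i)) = ∫ x in D, ℓ (f x) ∂μ := by
    intro ℓ
    rw [ℓ.integral_comp_comm hfi, ← hsum]
    simp
  refine ⟨N, fun k => √(w k) • Y (z k), fun ξ => ?_, ?_⟩
  · have h := key (((innerSL ℝ ξ).comp (ContinuousLinearMap.apply ℝ E ξ)).comp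
      (ContinuousLinearMap.fst ℝ _ _))
    convert h using 2 with k _ x
    · rw [real_inner_smul_left, mul_pow, Real.sq_sqrt (hw k)]
      simp [f, real_inner_comm, sq]
    · simp [f, real_inner_comm, sq]
  · have h := key (ContinuousLinearMap.snd ℝ _ _)
    convert h using 2 with k
    · simp [f, map_smul_eq_mul, mul_pow, Real.sq_sqrt (hw k)]
    · simp [f]

theorem average_sphere_le_of_typeTwo {n N : ℕ} (p : Seminorm ℝ (EuclideanSpace ℝ (Fin n)))
    (hp : Continuous p) {T : ℝ} (hT0 : 0 ≤ T)
    (hT : ∀ x : Fin N → EuclideanSpace ℝ (Fin n), (2 ^ N : ℝ)⁻¹ *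
        ∑ ε : Fin N → Bool, p (∑ i, (if ε i then (1 : ℝ) else -1) • x i) ^ 2 ≤
      T ^ 2 * ∑ i, p (x i) ^ 2)
    (v : Fin N → EuclideanSpace ℝ (Fin n)) {a : ℝ} (ha : 0 ≤ a)
    (hv : ∀ ξ, ∑ k, ⟪v k, ξ⟫ ^ 2 = a ^ 2 * ‖ξ‖ ^ 2) :
    a * ((⨍ ξ, p (ξ : EuclideanSpace ℝ (Fin n))
        ∂((volume : Measure (EuclideanSpace ℝ (Fin n))).toSphere)) *
      (√n * ∫ x, |x| ∂gaussianReal 0 1)) ≤ T * √(∑ k, p (v k) ^ 2) := by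
  rcases n.eq_zero_or_pos with rfl | hn
  · simp only [CharP.cast_eq_zero, Real.sqrt_zero, zero_mul, mul_zero]
    positivity
  have : NeZero n := ⟨hn.ne'⟩
  have hA : ∀ k, Measurable fun g : ℝ => g • v k := fun k => by fun_prop
  have hLp : ∀ k, MemLp (fun g : ℝ => p (g • v k)) 2 (gaussianReal 0 1) := by
    intro k
    simp only [map_smul_eq_mul]
    exact (memLp_id_gaussianReal 2).norm.mul_const _
  have hneg : MeasurePreserving (fun g : ℝ => -g) (gaussianReal 0 1) (gaussianReal 0 1) :=
    ⟨measurable_neg, by rw [gaussianReal_map_neg, neg_zero]⟩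
  have hm : Measurable fun g : Fin N → ℝ => ∑ k, g k • v k := by fun_prop
  have hLp' : MemLp (fun g : Fin N → ℝ => p (∑ k, g k • v k)) 2
      (Measure.pi fun _ : Fin N => gaussianReal 0 1) :=
    p.memLp_sum hp.measurable (fun k => (hA k).comp (measurable_pi_apply k)) fun k =>
      (hLp k).comp_measurePreserving (measurePreserving_eval _ k)
  have hsq : ∫ g, p (∑ k, g k • v k) ^ 2 ∂(Measure.pi fun _ : Fin N => gaussianReal 0 1) ≤
      T ^ 2 * ∑ k, p (v k) ^ 2 := by
    refine (p.integral_sq_sum_le_of_typeTwo hp.measurable hT (gaussianReal 0 1) hneg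
      (fun k g => g • v k) hA (fun k x => neg_smul _ _) hLp).trans_eq ?_
    congr 1
    refine Finset.sum_congr rfl fun k _ => ?_
    have h1 : ∫ x, x ^ 2 ∂gaussianReal 0 1 = 1 := by
      have := variance_of_integral_eq_zero (μ := gaussianReal 0 1) (X := fun x => x)
        (by fun_prop) (by simp)
      rw [← this, variance_fun_id_gaussianReal]
      simp
    simp only [map_smul_eq_mul, mul_pow, Real.norm_eq_abs, sq_abs]
    rw [integral_mul_const, h1, one_mul]
  have hM : 0 ≤ ⨍ ξ, p (ξ : EuclideanSpace ℝ (Fin n))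
      ∂((volume : Measure (EuclideanSpace ℝ (Fin n))).toSphere) :=
    integral_nonneg fun x => apply_nonneg p _
  calc _ ≤ a * ∫ x, p x ∂stdGaussian (EuclideanSpace ℝ (Fin n)) := by
        rw [integral_stdGaussian_eq_average_sphere_mul]
        gcongr
        exact sqrt_mul_le_integral_norm_stdGaussian n
    _ = ∫ g, p (∑ k, g k • v k) ∂(Measure.pi fun _ : Fin N => gaussianReal 0 1) := by
        rw [← integral_map (f := p) hm.aemeasurable hp.aestronglyMeasurable,
          map_pi_sum_smul_eq_map_smul_stdGaussian v a hv,
          integral_map (by fun_prop) hp.aestronglyMeasurable]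
        simp only [map_smul_eq_mul, Real.norm_of_nonneg ha]
        rw [integral_const_mul]
    _ ≤ √(T ^ 2 * ∑ k, p (v k) ^ 2) :=
        (integral_le_sqrt_integral_sq hLp').trans (Real.sqrt_le_sqrt hsq)
    _ = T * √(∑ k, p (v k) ^ 2) := by rw [Real.sqrt_mul (by positivity), Real.sqrt_sq hT0]

end Comparison

theorem IsSymmConvexBody.neg_mem {n : ℕ} {K : Set (EuclideanSpace ℝ (Fin n))}
    (hK : IsSymmConvexBody K) ⦃x : EuclideanSpace ℝ (Fin n)⦄ (hx : x ∈ K) : -x ∈ K := by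
  rw [hK.2.2.2]
  simpa using hx

theorem IsSymmConvexBody.mem_nhds_zero {n : ℕ} {K : Set (EuclideanSpace ℝ (Fin n))}
    (hK : IsSymmConvexBody K) : K ∈ nhds 0 := by
  obtain ⟨x, hx⟩ := hK.2.2.1
  have h : -x ∈ interior K := by
    rwa [hK.2.2.2, ← Set.neg_preimage, ← Homeomorph.coe_neg, ← (Homeomorph.neg _).preimage_interior,
      Set.mem_preimage, Homeomorph.coe_neg, neg_neg]
  rw [← mem_interior_iff_mem_nhds]
  simpa using hK.1.interior hx h (by norm_num : (0 : ℝ) ≤ 1 / 2) (by norm_num : (0 : ℝ) ≤ 1 / 2)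
    (by norm_num)

theorem IsSymmConvexBody.exists_seminorm {n : ℕ} {K : Set (EuclideanSpace ℝ (Fin n))}
    (hK : IsSymmConvexBody K) :
    ∃ p : Seminorm ℝ (EuclideanSpace ℝ (Fin n)), Continuous p ∧ ⇑p = gauge K := by
  let p := gaugeSeminorm (𝕜 := ℝ) ((balanced_iff_neg_mem hK.1).2 hK.neg_mem) hK.1
    (absorbent_nhds_zero hK.mem_nhds_zero)
  have hp : ⇑p = gauge K := rfl
  exact ⟨p, hp ▸ continuous_gauge hK.1 hK.mem_nhds_zero, hp⟩

theorem TypeTwoIneq.sq_le {n : ℕ} {K : Set (EuclideanSpace ℝ (Fin n))} {T : ℝ}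
    (h : TypeTwoIneq K T) (k : ℕ) (x : Fin k → EuclideanSpace ℝ (Fin n)) :
    (2 ^ k : ℝ)⁻¹ *
        ∑ ε : Fin k → Bool, gauge K (∑ i, (if ε i then (1 : ℝ) else -1) • x i) ^ 2 ≤
      T ^ 2 * ∑ i, gauge K (x i) ^ 2 := by
  have h1 := pow_le_pow_left₀ (Real.sqrt_nonneg _) (h k x) 2
  rwa [mul_pow, Real.sq_sqrt (by positivity), Real.sq_sqrt (by positivity)] at h1

theorem euclNorm_sq {s : ℕ} (t : Fin s → ℝ) : euclNorm t ^ 2 = ∑ j, t j ^ 2 :=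
  Real.sq_sqrt (by positivity)

theorem IsIsotropic.integral_inner_sq {n : ℕ} {C : Set (EuclideanSpace ℝ (Fin n))} {L : ℝ}
    (h : IsIsotropic C L) (ξ : EuclideanSpace ℝ (Fin n)) :
    ∫ x in C, ⟪x, ξ⟫ ^ 2 = L ^ 2 * ‖ξ‖ ^ 2 := by
  rcases eq_or_ne ξ 0 with rfl | hξ
  · simp
  have hn : ‖ξ‖ ≠ 0 := norm_ne_zero_iff.2 hξ
  rw [← h.2.2.2 (‖ξ‖⁻¹ • ξ) (by rw [norm_smul, norm_inv, norm_norm, inv_mul_cancel₀ hn]),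
    ← integral_mul_const]
  refine integral_congr_ae (.of_forall fun x => ?_)
  simp only [real_inner_smul_right]
  field_simp

theorem IsIsotropic.integral_inner_sum_sq {n s : ℕ} {C : Set (EuclideanSpace ℝ (Fin n))} {L : ℝ}
    (h : IsIsotropic C L) (hC : IsCompact C) (t : Fin s → ℝ) (ξ : EuclideanSpace ℝ (Fin n)) :
    ∫ x in Set.univ.pi fun _ : Fin s => C, ⟪∑ j, t j • x j, ξ⟫ ^ 2 =
      (L * euclNorm t) ^ 2 * ‖ξ‖ ^ 2 := by
  have : IsProbabilityMeasure (volume.restrict C) := ⟨by simpa using h.1⟩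
  rw [volume_pi, Measure.restrict_pi_pi]
  simp only [sum_inner, real_inner_smul_left]
  rw [integral_sq_sum_pi_eq (volume.restrict C) (f := fun j x => t j * ⟪x, ξ⟫)
    (fun j => Continuous.memLp_two_restrict hC (by fun_prop)) fun j => ?_]
  · simp only [mul_pow, integral_const_mul, h.integral_inner_sq]
    rw [← Finset.sum_mul, euclNorm_sq]
    ring
  · have hi : IntegrableOn (fun x => x) C (volume : Measure (EuclideanSpace ℝ (Fin n))) :=
      continuousOn_id.integrableOn_compact hC
    have := (innerSL ℝ ξ).integral_comp_comm hi
    simp only [innerSL_apply_apply, h.2.1, inner_zero_right] at this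
    simp only [integral_const_mul, real_inner_comm ξ, this, mul_zero]

/-- Second and first moments of `p (∑ t_j x_j)` over `C^s` agree up to
an absolute constant. -/
theorem integral_sq_sum_smul_le {n s : ℕ} {C : Set (EuclideanSpace ℝ (Fin n))}
    (hC : Convex ℝ C) (hCc : IsCompact C) (hC1 : volume C = 1)
    (p : Seminorm ℝ (EuclideanSpace ℝ (Fin n))) (hp : Continuous p) (t : Fin s → ℝ) :
    ∫ x in Set.univ.pi fun _ : Fin s => C, p (∑ j, t j • x j) ^ 2 ≤
      (90 * ∫ x in Set.univ.pi fun _ : Fin s => C, p (∑ j, t j • x j)) ^ 2 := by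
  have hD : IsCompact (Set.univ.pi fun _ : Fin s => C) := isCompact_univ_pi fun _ => hCc
  have : IsProbabilityMeasure ((volume : Measure (Fin s → EuclideanSpace ℝ (Fin n))).restrict
      (Set.univ.pi fun _ : Fin s => C)) := ⟨by simp [volume_pi_pi, hC1]⟩
  let T : (Fin s → EuclideanSpace ℝ (Fin n)) →ₗ[ℝ] EuclideanSpace ℝ (Fin n) :=
    ∑ j, t j • LinearMap.proj j
  have hT : ∀ x, p.comp T x = p (∑ j, t j • x j) := fun x => by simp [T]
  have hq : Continuous (p.comp T) := by
    simp only [funext hT]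
    fun_prop
  have h := ((midpointPrekopaLeindler_euclideanSpace n).pi s).integral_sq_le hD.measurableSet
    (convex_pi fun _ _ => hC) (p.comp T) hq.measurable (hq.memLp_two_restrict hD)
  simpa only [hT] using h

/-- there are absolute constants `c₁, c₂ > 0` such that for any isotropic
centrally symmetric convex body `C` in `ℝⁿ` and any centrally symmetric convex body `K`
with type-2 constant `T₂(X_K)`, for every `s ≥ 1` and `t ∈ ℝˢ`,
`(c₁ L_C √n M(K)/T₂(X_K)) ‖t‖₂ ≤ ∫_C⋯∫_C ‖∑ t_j x_j‖_K ≤ c₂ T₂(X_K) (∫_C ‖x‖_K dx) ‖t‖₂`. -/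
theorem stmt12 :
    ∃ c₁ c₂ : ℝ, 0 < c₁ ∧ 0 < c₂ ∧
      ∀ (n s : ℕ) (_hs : 1 ≤ s)
        (C : Set (EuclideanSpace ℝ (Fin n))) (_hC : IsSymmConvexBody C)
        (L : ℝ) (_hCiso : IsIsotropic C L)
        (K : Set (EuclideanSpace ℝ (Fin n))) (_hK : IsSymmConvexBody K)
        (T₂ : ℝ) (_hT₂ : IsLeast {c : ℝ | 0 < c ∧ TypeTwoIneq K c} T₂)
        (t : Fin s → ℝ),
        c₁ * L * Real.sqrt n * sphereM K / T₂ * euclNorm t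
            ≤ (∫ x in Set.univ.pi fun _ : Fin s => C, gauge K (∑ j, t j • x j)) ∧
          (∫ x in Set.univ.pi fun _ : Fin s => C, gauge K (∑ j, t j • x j))
            ≤ c₂ * T₂ * (∫ x in C, gauge K x) * euclNorm t := by
  set κ := ∫ x, |x| ∂ProbabilityTheory.gaussianReal 0 1 with hκ
  have hκ0 : 0 < κ := integral_abs_gaussianReal_pos
  refine ⟨κ / 90, 90, by positivity, by norm_num, ?_⟩
  intro n s _ C hC L hL K hK T hTmin t
  obtain ⟨hT0, hT⟩ := hTmin.1
  obtain ⟨p, hp, hpK⟩ := hK.exists_seminorm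
  have hT2 := hT.sq_le
  simp only [sphereM]
  rw [← hpK] at hT2 ⊢
  set D := Set.univ.pi fun _ : Fin s => C
  have hD : IsCompact D := isCompact_univ_pi fun _ => hC.2.1
  have hν : IsProbabilityMeasure (volume.restrict C) := ⟨by simpa using hL.1⟩
  have hDν : (volume.restrict D : Measure (Fin s → EuclideanSpace ℝ (Fin n))) =
      Measure.pi fun _ => volume.restrict C := by
    rw [volume_pi, Measure.restrict_pi_pi]
  have hDp : IsProbabilityMeasure
      (volume.restrict D : Measure (Fin s → EuclideanSpace ℝ (Fin n))) := by
    rw [hDν]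
    infer_instance
  have ht0 : 0 ≤ euclNorm t := Real.sqrt_nonneg _
  have hI0 : 0 ≤ ∫ x in D, p (∑ j, t j • x j) := integral_nonneg fun _ => apply_nonneg p _
  have hJ0 : 0 ≤ ∫ x in C, p x := integral_nonneg fun _ => apply_nonneg p _
  have hsq : ∫ x in D, p (∑ j, t j • x j) ^ 2 ≤ (90 * ∫ x in D, p (∑ j, t j • x j)) ^ 2 :=
    integral_sq_sum_smul_le hC.1 hC.2.1 hL.1 p hp t
  constructor
  · obtain ⟨N, v, hv, hvp⟩ := exists_sum_inner_sq_eq_integral (μ := volume) hD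
      (Y := fun x : Fin s → EuclideanSpace ℝ (Fin n) => ∑ j, t j • x j) (by fun_prop) p hp
    have h := average_sphere_le_of_typeTwo p hp hT0.le (hT2 N) v (mul_nonneg hL.2.2.1.le ht0)
      fun ξ => by rw [hv, hL.integral_inner_sum_sq hC.2.1]
    rw [hvp] at h
    have h2 := h.trans (mul_le_mul_of_nonneg_left
      ((Real.sqrt_le_sqrt hsq).trans_eq (Real.sqrt_sq (by positivity))) hT0.le)
    rw [← hκ] at h2
    rw [div_mul_eq_mul_div, div_le_iff₀ hT0]
    linarith
  · have hneg : MeasurePreserving (fun x : EuclideanSpace ℝ (Fin n) => -x) (volume.restrict C)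
        (volume.restrict C) := by
      have := (Measure.measurePreserving_neg
        (volume : Measure (EuclideanSpace ℝ (Fin n)))).restrict_preimage hC.2.1.measurableSet
      rwa [Set.neg_preimage, ← hC.2.2.2] at this
    have h1 := p.integral_sq_sum_le_of_typeTwo hp.measurable (hT2 s) (volume.restrict C) hneg
      (fun j x => t j • x) (fun j => by fun_prop) (fun j x => smul_neg _ _)
      fun j => Continuous.memLp_two_restrict hC.2.1 (by fun_prop)
    rw [← hDν] at h1
    simp only [map_smul_eq_mul, mul_pow, integral_const_mul, Real.norm_eq_abs, sq_abs] at h1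
    rw [← Finset.sum_mul, ← euclNorm_sq] at h1
    have h2 : ∫ x in C, p x ^ 2 ≤ (90 * ∫ x in C, p x) ^ 2 :=
      (midpointPrekopaLeindler_euclideanSpace n).integral_sq_le hC.2.1.measurableSet hC.1 p
        hp.measurable (hp.memLp_two_restrict hC.2.1)
    have hf : Continuous fun x : Fin s → EuclideanSpace ℝ (Fin n) => p (∑ j, t j • x j) := by
      fun_prop
    calc ∫ x in D, p (∑ j, t j • x j) ≤ √(∫ x in D, p (∑ j, t j • x j) ^ 2) :=
          integral_le_sqrt_integral_sq (hf.memLp_two_restrict hD)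
      _ ≤ √((90 * T * (∫ x in C, p x) * euclNorm t) ^ 2) := by
          refine Real.sqrt_le_sqrt (h1.trans ?_)
          calc T ^ 2 * (euclNorm t ^ 2 * ∫ x in C, p x ^ 2)
              ≤ T ^ 2 * (euclNorm t ^ 2 * (90 * ∫ x in C, p x) ^ 2) := by gcongr
            _ = _ := by ring
      _ = _ := Real.sqrt_sq (by positivity)
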